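/- Let p ∈ [0,1], let n = 2^k be a power of 2, let X = [X_1,…,X_n] be i.i.d. Bernoulli(p) random variables viewed as a row vector over F_2, and let Y = X·G_n. Then for every ε ∈ (0,1), the quantity (1/n)·|{ j ∈ {1,…,n} : H(Y_j | Y_1,…,Y_{j-1}) ≥ 1 − ε }| converges, as k → ∞, to h(p), the binary entropy of a Bernoulli(p) distribution. -/

import Mathlib

open MeasureTheory ProbabilityTheory Filter
open scoped Classical

/-- Shannon entropy (in bits) of a finite-valued random variable `X` on `(Ω, μ)`:
`H(X) = ∑ₓ P(X = x) log₂ (1 / P(X = x))`. -/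
noncomputable def shEnt {Ω : Type*} [MeasurableSpace Ω] (μ : Measure Ω)
    {α : Type*} [Fintype α] (X : Ω → α) : ℝ :=
  (∑ x : α, Real.negMulLog ((μ (X ⁻¹' {x})).toReal)) / Real.log 2

/-- Conditional Shannon entropy (in bits) of discrete random variables:
`H(X | Y) = H(X, Y) - H(Y)`. -/
noncomputable def cEnt {Ω : Type*} [MeasurableSpace Ω] (μ : Measure Ω)
    {α β : Type*} [Fintype α] [Fintype β] (X : Ω → α) (Y : Ω → β) : ℝ :=
  shEnt μ (fun ω => (X ω, Y ω)) - shEnt μ Y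

/-- Shannon entropy (in bits) of a distribution on a finite set. -/
noncomputable def distEnt {α : Type*} [MeasurableSpace α] [Fintype α] (ν : Measure α) : ℝ :=
  (∑ x : α, Real.negMulLog ((ν {x}).toReal)) / Real.log 2

/-- The binary entropy function `h(p) = -p log₂ p - (1-p) log₂ (1-p)`. -/
noncomputable def binEnt (p : ℝ) : ℝ :=
  (Real.negMulLog p + Real.negMulLog (1 - p)) / Real.log 2

/-- The Bernoulli(p) distribution on `F₂` (probability `p` of the outcome `1`). -/
noncomputable def bern (p : ℝ) : Measure (ZMod 2) :=
  ENNReal.ofReal (1 - p) • Measure.dirac 0 + ENNReal.ofReal p • Measure.dirac 1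

/-- `G k` is the `2^k × 2^k` matrix over `F₂` given by the `k`-fold Kronecker power of
`[[1,0],[1,1]]`, in closed form: the `(i,j)` entry is `1` iff each binary digit of `j`
is dominated by the corresponding binary digit of `i` (for the single factor
`[[1,0],[1,1]]`, the `(a,b)` entry is `1` iff the bit `b` is dominated by the bit `a`,
and the Kronecker power multiplies these bitwise conditions). -/
def G (k : ℕ) : Matrix (Fin (2 ^ k)) (Fin (2 ^ k)) (ZMod 2) :=
  Matrix.of fun i j => if j.val &&& i.val = j.val then 1 else 0

theorem sum_range_two_mul (f : ℕ → ℝ) (n : ℕ) :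
    ∑ i ∈ Finset.range (2 * n), f i = ∑ j ∈ Finset.range n, (f (2 * j) + f (2 * j + 1)) := by
  induction n with
  | zero => simp
  | succ n ih =>
    rw [Finset.sum_range_succ, ← ih, show 2 * (n + 1) = 2 * n + 1 + 1 by ring,
      Finset.sum_range_succ, Finset.sum_range_succ]
    ring

/-- The average of the first `2 ^ k` values of a sequence. -/
noncomputable def dyadicAvg (k : ℕ) (f : ℕ → ℝ) : ℝ :=
  (∑ j ∈ Finset.range (2 ^ k), f j) / 2 ^ k

theorem dyadicAvg_succ (k : ℕ) (f : ℕ → ℝ) :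
    dyadicAvg (k + 1) f = dyadicAvg k fun j => (f (2 * j) + f (2 * j + 1)) / 2 := by
  unfold dyadicAvg
  rw [← Finset.sum_div, pow_succ', sum_range_two_mul, div_div, pow_succ']

theorem dyadicAvg_mono (k : ℕ) {f g : ℕ → ℝ} (h : ∀ j, f j ≤ g j) :
    dyadicAvg k f ≤ dyadicAvg k g := by
  unfold dyadicAvg
  gcongr
  exact h _

theorem dyadicAvg_add (k : ℕ) (f g : ℕ → ℝ) :
    dyadicAvg k (fun j => f j + g j) = dyadicAvg k f + dyadicAvg k g := by
  simp only [dyadicAvg, Finset.sum_add_distrib, add_div]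

theorem dyadicAvg_sub (k : ℕ) (f g : ℕ → ℝ) :
    dyadicAvg k (fun j => f j - g j) = dyadicAvg k f - dyadicAvg k g := by
  simp only [dyadicAvg, Finset.sum_sub_distrib, sub_div]

theorem dyadicAvg_const_mul (k : ℕ) (c : ℝ) (f : ℕ → ℝ) :
    dyadicAvg k (fun j => c * f j) = c * dyadicAvg k f := by
  simp only [dyadicAvg, ← Finset.mul_sum, mul_div_assoc]

theorem dyadicAvg_const (k : ℕ) (c : ℝ) : dyadicAvg k (fun _ => c) = c := by
  simp [dyadicAvg]

theorem abs_dyadicAvg_le (k : ℕ) (f : ℕ → ℝ) :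
    |dyadicAvg k f| ≤ dyadicAvg k fun j => |f j| := by
  unfold dyadicAvg
  rw [abs_div, abs_of_pos (by positivity : (0 : ℝ) < 2 ^ k)]
  gcongr
  exact Finset.abs_sum_le_sum_abs _ _

section Polarization

variable {g : ℕ → ℕ → ℝ} {c : ℝ}

theorem dyadicAvg_eq_of_split
    (hsum : ∀ k j, g (k + 1) (2 * j) + g (k + 1) (2 * j + 1) = 2 * g k j) (k : ℕ) :
    dyadicAvg k (g k) = g 0 0 := by
  induction k with
  | zero => simp [dyadicAvg]
  | succ k ih =>
    rw [dyadicAvg_succ, ← ih]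
    congr 1
    ext j
    rw [hsum]
    ring

theorem tendsto_dyadicAvg_gap (hc : 0 < c) (h0 : ∀ k j, 0 ≤ g k j) (h1 : ∀ k j, g k j ≤ 1)
    (hsum : ∀ k j, g (k + 1) (2 * j) + g (k + 1) (2 * j + 1) = 2 * g k j)
    (hgap : ∀ k j, g k j + c * ((1 - g k j) * g k j ^ 2) ≤ g (k + 1) (2 * j)) :
    Tendsto (fun k => dyadicAvg k fun j => ((1 - g k j) * g k j ^ 2) ^ 2) atTop (nhds 0) := by
  set V : ℕ → ℝ := fun k => dyadicAvg k fun j => g k j ^ 2 with hV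
  have hB : ∀ k, 0 ≤ dyadicAvg k fun j => ((1 - g k j) * g k j ^ 2) ^ 2 := fun k => by
    unfold dyadicAvg
    positivity
  have hstep : ∀ k, V k + c ^ 2 * (dyadicAvg k fun j => ((1 - g k j) * g k j ^ 2) ^ 2)
      ≤ V (k + 1) := by
    intro k
    simp only [hV]
    rw [dyadicAvg_succ, ← dyadicAvg_const_mul, ← dyadicAvg_add]
    refine dyadicAvg_mono k fun j => ?_
    have ha := hsum k j
    have hb := hgap k j
    have hd : 0 ≤ c * ((1 - g k j) * g k j ^ 2) :=
      mul_nonneg hc.le (mul_nonneg (sub_nonneg.2 (h1 k j)) (sq_nonneg _))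
    have hodd : g (k + 1) (2 * j + 1) = 2 * g k j - g (k + 1) (2 * j) := by linarith
    rw [hodd]
    have := pow_le_pow_left₀ hd (by linarith :
      c * ((1 - g k j) * g k j ^ 2) ≤ g (k + 1) (2 * j) - g k j) 2
    nlinarith
  have hmono : Monotone V := monotone_nat_of_le_succ fun k => by
    have := mul_nonneg (sq_nonneg c) (hB k)
    linarith [hstep k]
  have hbdd : BddAbove (Set.range V) := by
    refine ⟨1, ?_⟩
    rintro _ ⟨k, rfl⟩
    rw [← dyadicAvg_const k 1]
    exact dyadicAvg_mono k fun j => pow_le_one₀ (h0 k j) (h1 k j)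
  have hlim := tendsto_atTop_ciSup hmono hbdd
  have hdiff : Tendsto (fun k => (V (k + 1) - V k) / c ^ 2) atTop (nhds 0) := by
    have := ((hlim.comp (tendsto_add_atTop_nat 1)).sub hlim).div_const (c ^ 2)
    simpa using this
  refine squeeze_zero hB (fun k => ?_) hdiff
  rw [le_div_iff₀ (by positivity)]
  linarith [hstep k]

theorem abs_indicator_sub_le {ε η t : ℝ} (hη : 0 < η) (hηε : η ≤ ε) (hηε' : η < 1 - ε)
    (h0 : 0 ≤ t) (h1 : t ≤ 1) :
    |(if 1 - ε ≤ t then (1 : ℝ) else 0) - t| ≤ η + (η ^ 6)⁻¹ * ((1 - t) * t ^ 2) ^ 2 := by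
  have hpos : 0 ≤ (η ^ 6)⁻¹ * ((1 - t) * t ^ 2) ^ 2 := by positivity
  rcases le_or_gt t η with ht | ht
  · rw [if_neg (by linarith), zero_sub, abs_neg, abs_of_nonneg h0]
    linarith
  rcases le_or_gt (1 - η) t with ht' | ht'
  · rw [if_pos (by linarith), abs_of_nonneg (by linarith)]
    linarith
  · have hm : η * η ^ 2 ≤ (1 - t) * t ^ 2 := by
      gcongr
      linarith
    have hm2 : η ^ 6 ≤ ((1 - t) * t ^ 2) ^ 2 := by
      calc η ^ 6 = (η * η ^ 2) ^ 2 := by ring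
        _ ≤ _ := by gcongr
    have h1' : 1 ≤ (η ^ 6)⁻¹ * ((1 - t) * t ^ 2) ^ 2 := by
      rw [inv_mul_eq_div, le_div_iff₀ (by positivity)]
      linarith
    have : |(if 1 - ε ≤ t then (1 : ℝ) else 0) - t| ≤ 1 := by
      rw [abs_le]
      split_ifs <;> constructor <;> linarith
    linarith

theorem tendsto_dyadicAvg_indicator (hc : 0 < c) (h0 : ∀ k j, 0 ≤ g k j) (h1 : ∀ k j, g k j ≤ 1)
    (hsum : ∀ k j, g (k + 1) (2 * j) + g (k + 1) (2 * j + 1) = 2 * g k j)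
    (hgap : ∀ k j, g k j + c * ((1 - g k j) * g k j ^ 2) ≤ g (k + 1) (2 * j))
    {ε : ℝ} (hε0 : 0 < ε) (hε1 : ε < 1) :
    Tendsto (fun k => dyadicAvg k fun j => if 1 - ε ≤ g k j then 1 else 0) atTop
      (nhds (g 0 0)) := by
  rw [Metric.tendsto_atTop]
  intro δ hδ
  obtain ⟨η, hη, hηlt⟩ := exists_between (show 0 < min (min ε (1 - ε)) (δ / 2) by
    simp only [lt_min_iff]
    exact ⟨⟨hε0, by linarith⟩, by linarith⟩)
  simp only [lt_min_iff] at hηlt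
  have hlim := (tendsto_dyadicAvg_gap hc h0 h1 hsum hgap).const_mul (η ^ 6)⁻¹
  rw [mul_zero] at hlim
  obtain ⟨N, hN⟩ := eventually_atTop.1 (hlim.eventually_lt_const (half_pos hδ))
  refine ⟨N, fun k hk => ?_⟩
  rw [Real.dist_eq, ← dyadicAvg_eq_of_split hsum k, ← dyadicAvg_sub]
  refine (abs_dyadicAvg_le _ _).trans_lt ?_
  refine (dyadicAvg_mono k fun j => abs_indicator_sub_le hη hηlt.1.1.le hηlt.1.2
    (h0 k j) (h1 k j)).trans_lt ?_
  rw [dyadicAvg_add, dyadicAvg_const, dyadicAvg_const_mul]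
  linarith [hN k hk, hηlt.2]

end Polarization

/-- The unnormalised binary entropy (in nats) of a pair of nonnegative masses. -/
noncomputable def massEnt (a b : ℝ) : ℝ :=
  Real.negMulLog a + Real.negMulLog b - Real.negMulLog (a + b)

theorem massEnt_comm (a b : ℝ) : massEnt a b = massEnt b a := by
  unfold massEnt
  rw [add_comm a b]
  ring

theorem massEnt_eq_mul_binEntropy {a b : ℝ} (ha : 0 ≤ a) (hb : 0 ≤ b) :
    massEnt a b = (a + b) * Real.binEntropy (a / (a + b)) := by
  rcases (add_nonneg ha hb).eq_or_lt with h | h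
  · obtain rfl : a = 0 := by linarith
    obtain rfl : b = 0 := by linarith
    simp [massEnt]
  · have h1 : 1 - a / (a + b) = b / (a + b) := by field_simp; ring
    have key : ∀ x : ℝ, (a + b) * Real.negMulLog (x / (a + b)) =
        Real.negMulLog x + x * Real.log (a + b) := by
      intro x
      rcases eq_or_ne x 0 with rfl | hx
      · simp
      · rw [Real.negMulLog, Real.log_div hx h.ne', Real.negMulLog]
        field_simp
        ring
    rw [Real.binEntropy_eq_negMulLog_add_negMulLog_one_sub, h1, mul_add, key, key, massEnt]
    simp only [Real.negMulLog]
    ring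

theorem massEnt_nonneg {a b : ℝ} (ha : 0 ≤ a) (hb : 0 ≤ b) : 0 ≤ massEnt a b := by
  rw [massEnt_eq_mul_binEntropy ha hb]
  exact mul_nonneg (by positivity) (Real.binEntropy_nonneg (by positivity)
    (div_le_one_of_le₀ (by linarith) (by positivity)))

theorem massEnt_le {a b : ℝ} (ha : 0 ≤ a) (hb : 0 ≤ b) : massEnt a b ≤ (a + b) * Real.log 2 := by
  rw [massEnt_eq_mul_binEntropy ha hb]
  exact mul_le_mul_of_nonneg_left Real.binEntropy_le_log_two (by positivity)

theorem massEnt_smul (c a b : ℝ) :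
    massEnt (c * a) (c * b) = c * massEnt a b := by
  unfold massEnt
  rw [← mul_add]
  simp only [Real.negMulLog_mul]
  ring

theorem massEnt_self (a : ℝ) : massEnt a a = 2 * a * Real.log 2 := by
  unfold massEnt
  rw [← two_mul a, Real.negMulLog_mul, Real.negMulLog]
  simp only [Real.negMulLog]
  ring

theorem massEnt_add_le {a b c d : ℝ} (ha : 0 ≤ a) (hb : 0 ≤ b) (hc : 0 ≤ c) (hd : 0 ≤ d) :
    massEnt a b + massEnt c d ≤ massEnt (a + c) (b + d) := by
  rcases (add_nonneg ha hb).eq_or_lt with h | h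
  · obtain rfl : a = 0 := by linarith
    obtain rfl : b = 0 := by linarith
    simp [massEnt]
  rcases (add_nonneg hc hd).eq_or_lt with h' | h'
  · obtain rfl : c = 0 := by linarith
    obtain rfl : d = 0 := by linarith
    simp [massEnt]
  have hpos : 0 < a + b + (c + d) := by linarith
  have hx : a / (a + b) ∈ Set.Icc (0 : ℝ) 1 :=
    ⟨by positivity, div_le_one_of_le₀ (by linarith) h.le⟩
  have hy : c / (c + d) ∈ Set.Icc (0 : ℝ) 1 :=
    ⟨by positivity, div_le_one_of_le₀ (by linarith) h'.le⟩
  have hw : (a + b) / (a + b + (c + d)) + (c + d) / (a + b + (c + d)) = 1 := by field_simp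
  have hconc := Real.strictConcave_binEntropy.concaveOn.2 hx hy
    (by positivity) (by positivity) hw
  simp only [smul_eq_mul] at hconc
  have e : (a + b) / (a + b + (c + d)) * (a / (a + b)) + (c + d) / (a + b + (c + d)) *
      (c / (c + d)) = (a + c) / (a + c + (b + d)) := by
    rw [show a + c + (b + d) = a + b + (c + d) by ring]
    field_simp
  rw [e] at hconc
  have := mul_le_mul_of_nonneg_left hconc hpos.le
  rw [massEnt_eq_mul_binEntropy ha hb, massEnt_eq_mul_binEntropy hc hd,
    massEnt_eq_mul_binEntropy (add_nonneg ha hc) (add_nonneg hb hd)]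
  refine le_trans (le_of_eq ?_) (this.trans (le_of_eq ?_))
  · field_simp
  · ring

/-- Convolving with a second pair of masses moves the entropy towards its maximal value. -/
theorem massEnt_conv_ge {a b c d : ℝ} (ha : 0 ≤ a) (hb : 0 ≤ b) (hc : 0 ≤ c) (hd : 0 ≤ d) :
    (c + d) * massEnt a b + 2 * min c d * ((a + b) * Real.log 2 - massEnt a b) ≤
      massEnt (a * c + b * d) (a * d + b * c) := by
  rcases le_total d c with h | h
  · have h1 := massEnt_add_le (mul_nonneg (sub_nonneg.2 h) ha) (mul_nonneg (sub_nonneg.2 h) hb)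
      (mul_nonneg hd (add_nonneg ha hb)) (mul_nonneg hd (add_nonneg ha hb))
    rw [massEnt_smul, massEnt_self] at h1
    rw [min_eq_right h]
    convert h1 using 1
    · ring
    · congr 1 <;> ring
  · have h1 := massEnt_add_le (mul_nonneg (sub_nonneg.2 h) hb) (mul_nonneg (sub_nonneg.2 h) ha)
      (mul_nonneg hc (add_nonneg ha hb)) (mul_nonneg hc (add_nonneg ha hb))
    rw [massEnt_smul, massEnt_self, massEnt_comm b a] at h1
    rw [min_eq_left h]
    convert h1 using 1
    · ring
    · congr 1 <;> ring

theorem negMulLog_le_two_sqrt {q : ℝ} (hq : 0 ≤ q) : Real.negMulLog q ≤ 2 * √q := by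
  rcases hq.eq_or_lt with rfl | hq
  · simp
  have hs : 0 < √q := Real.sqrt_pos.2 hq
  have h1 := Real.log_le_sub_one_of_pos (inv_pos.2 hs)
  rw [Real.log_inv, Real.log_sqrt hq.le] at h1
  have h2 : -Real.log q ≤ 2 * (√q)⁻¹ := by linarith
  have h3 := mul_le_mul_of_nonneg_left h2 hq.le
  have h4 : q * (2 * (√q)⁻¹) = 2 * √q := by
    nth_rewrite 1 [← Real.mul_self_sqrt hq.le]
    field_simp
  rw [Real.negMulLog]
  linarith

theorem binEntropy_sq_le {q : ℝ} (h0 : 0 ≤ q) (h1 : q ≤ 1) : Real.binEntropy q ^ 2 ≤ 9 * q := by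
  have hs : q ≤ √q := Real.le_sqrt_of_sq_le (by nlinarith)
  have h2 : Real.negMulLog (1 - q) ≤ q := by
    have := Real.negMulLog_le_one_sub_self (x := 1 - q) (by linarith)
    linarith
  have h3 : Real.binEntropy q ≤ 3 * √q := by
    rw [Real.binEntropy_eq_negMulLog_add_negMulLog_one_sub]
    linarith [negMulLog_le_two_sqrt h0]
  calc Real.binEntropy q ^ 2 ≤ (3 * √q) ^ 2 :=
        pow_le_pow_left₀ (Real.binEntropy_nonneg h0 h1) h3 2
    _ = 9 * q := by rw [mul_pow, Real.sq_sqrt h0]; norm_num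

theorem massEnt_sq_le {a b : ℝ} (ha : 0 ≤ a) (hb : 0 ≤ b) :
    massEnt a b ^ 2 ≤ (a + b) * (9 * min a b) := by
  have key : ∀ x y : ℝ, 0 ≤ x → 0 ≤ y → massEnt x y ^ 2 ≤ (x + y) * (9 * x) := by
    intro x y hx hy
    rcases (add_nonneg hx hy).eq_or_lt with h | h
    · obtain rfl : x = 0 := by linarith
      obtain rfl : y = 0 := by linarith
      simp [massEnt]
    · rw [massEnt_eq_mul_binEntropy hx hy, mul_pow]
      have := binEntropy_sq_le (q := x / (x + y)) (by positivity)
        (div_le_one_of_le₀ (by linarith) h.le)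
      calc (x + y) ^ 2 * Real.binEntropy (x / (x + y)) ^ 2 ≤
          (x + y) ^ 2 * (9 * (x / (x + y))) := by gcongr
        _ = (x + y) * (9 * x) := by field_simp
  rcases le_total a b with h | h
  · rw [min_eq_left h]
    exact key a b ha hb
  · rw [min_eq_right h, massEnt_comm, add_comm]
    exact key b a hb ha

theorem sum_massEnt_conv_ge {β : Type*} [Fintype β] {r s : β → ℝ} (hr : ∀ z, 0 ≤ r z)
    (hs : ∀ z, 0 ≤ s z) (hsum : ∑ z, (r z + s z) = 1) :
    (∑ z, massEnt (r z) (s z)) + 2 / 9 * ((Real.log 2 - ∑ z, massEnt (r z) (s z)) *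
        (∑ z, massEnt (r z) (s z)) ^ 2) ≤
      ∑ z, ∑ z', massEnt (r z * r z' + s z * s z') (r z * s z' + s z * r z') := by
  set h := ∑ z, massEnt (r z) (s z) with hh
  have hle : h ≤ Real.log 2 := by
    calc h ≤ ∑ z, (r z + s z) * Real.log 2 :=
          Finset.sum_le_sum fun z _ => massEnt_le (hr z) (hs z)
      _ = Real.log 2 := by rw [← Finset.sum_mul, hsum, one_mul]
  have hCS : h ^ 2 ≤ 9 * ∑ z, min (r z) (s z) := by
    have := Finset.sum_sq_le_sum_mul_sum_of_sq_le_mul Finset.univ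
      (r := fun z => massEnt (r z) (s z)) (f := fun z => r z + s z)
      (g := fun z => 9 * min (r z) (s z))
      (fun z _ => add_nonneg (hr z) (hs z))
      (fun z _ => mul_nonneg (by norm_num) (le_min (hr z) (hs z)))
      (fun z _ => massEnt_sq_le (hr z) (hs z))
    rwa [hsum, one_mul, ← Finset.mul_sum] at this
  have hmain : h + 2 * (∑ z, min (r z) (s z)) * (Real.log 2 - h) ≤
      ∑ z, ∑ z', massEnt (r z * r z' + s z * s z') (r z * s z' + s z * r z') := by
    calc _ = ∑ z, ∑ z', ((r z' + s z') * massEnt (r z) (s z) +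
          2 * min (r z') (s z') * ((r z + s z) * Real.log 2 - massEnt (r z) (s z))) := by
          simp only [Finset.sum_add_distrib, ← Finset.sum_mul, ← Finset.mul_sum, hsum,
            Finset.sum_sub_distrib, one_mul]
          rw [hh]
      _ ≤ _ := Finset.sum_le_sum fun z _ => Finset.sum_le_sum fun z' _ =>
          massEnt_conv_ge (hr z) (hs z) (hr z') (hs z')
  nlinarith [mul_le_mul_of_nonneg_right hCS (sub_nonneg.2 hle)]

section FiniteEntropy

variable {Ω Ω' α β : Type*} [Fintype Ω] [Fintype Ω']

/-- The mass that the weight `P` gives to the fibre of `X` over `a`. -/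
noncomputable def fibMass (P : Ω → ℝ) (X : Ω → α) (a : α) : ℝ :=
  ∑ ω, if X ω = a then P ω else 0

/-- The entropy (in nats) of `X` when the outcomes are weighted by `P`. -/
noncomputable def wEnt [Fintype α] (P : Ω → ℝ) (X : Ω → α) : ℝ :=
  ∑ a, Real.negMulLog (fibMass P X a)

theorem fibMass_nonneg {P : Ω → ℝ} (hP : ∀ ω, 0 ≤ P ω) (X : Ω → α) (a : α) :
    0 ≤ fibMass P X a :=
  Finset.sum_nonneg fun ω _ => by split_ifs <;> simp [hP]

theorem sum_fibMass [Fintype α] (P : Ω → ℝ) (X : Ω → α) : ∑ a, fibMass P X a = ∑ ω, P ω := by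
  unfold fibMass
  rw [Finset.sum_comm]
  simp

theorem wEnt_eq_sum_mul_log [Fintype α] (P : Ω → ℝ) (X : Ω → α) :
    wEnt P X = ∑ ω, P ω * -Real.log (fibMass P X (X ω)) := by
  unfold wEnt
  have : ∀ a, Real.negMulLog (fibMass P X a) =
      ∑ ω, if X ω = a then P ω * -Real.log (fibMass P X (X ω)) else 0 := by
    intro a
    rw [Real.negMulLog]
    nth_rewrite 1 [fibMass]
    rw [neg_mul, ← mul_neg, Finset.sum_mul]
    refine Finset.sum_congr rfl fun ω _ => ?_
    split_ifs with h
    · rw [h]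
    · simp
  simp only [this]
  rw [Finset.sum_comm]
  simp

theorem wEnt_congr_of_ker [Fintype α] [Fintype β] (P : Ω → ℝ) {X : Ω → α} {Y : Ω → β}
    (h : ∀ ω ω', X ω = X ω' ↔ Y ω = Y ω') : wEnt P X = wEnt P Y := by
  simp only [wEnt_eq_sum_mul_log, fibMass, h]

theorem wEnt_comp_equiv [Fintype α] (e : Ω ≃ Ω') (P : Ω' → ℝ) (X : Ω' → α) :
    wEnt (P ∘ e) (X ∘ e) = wEnt P X := by
  unfold wEnt fibMass
  congr 1
  ext a
  congr 1
  exact e.sum_comp fun ω => if X ω = a then P ω else 0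

theorem fibMass_prod (P : Ω → ℝ) (Q : Ω' → ℝ) (X : Ω → α) (Y : Ω' → β) (c : α × β) :
    fibMass (fun ω : Ω × Ω' => P ω.1 * Q ω.2) (fun ω => (X ω.1, Y ω.2)) c =
      fibMass P X c.1 * fibMass Q Y c.2 := by
  unfold fibMass
  rw [Finset.sum_mul_sum, Fintype.sum_prod_type]
  refine Finset.sum_congr rfl fun ω _ => Finset.sum_congr rfl fun ω' _ => ?_
  by_cases h1 : X ω = c.1 <;> by_cases h2 : Y ω' = c.2 <;> simp [h1, h2, Prod.ext_iff]

theorem wEnt_prod [Fintype α] [Fintype β] {P : Ω → ℝ} {Q : Ω' → ℝ} (hP : ∑ ω, P ω = 1) (hQ : ∑ ω, Q ω = 1)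
    (X : Ω → α) (Y : Ω' → β) :
    wEnt (fun ω : Ω × Ω' => P ω.1 * Q ω.2) (fun ω => (X ω.1, Y ω.2)) = wEnt P X + wEnt Q Y := by
  have hX : ∑ a, fibMass P X a = 1 := by rw [sum_fibMass, hP]
  have hY : ∑ b, fibMass Q Y b = 1 := by rw [sum_fibMass, hQ]
  unfold wEnt
  simp only [fibMass_prod, Real.negMulLog_mul, Fintype.sum_prod_type, Finset.sum_add_distrib,
    ← Finset.sum_mul, ← Finset.mul_sum, hX, hY, one_mul]

theorem sum_zmod_two {M : Type*} [AddCommMonoid M] (f : ZMod 2 → M) : ∑ a, f a = f 0 + f 1 :=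
  Fin.sum_univ_two f

theorem zmod_two_eq_zero_or_one (a : ZMod 2) : a = 0 ∨ a = 1 := by
  revert a
  decide

theorem fibMass_eq_add (P : Ω → ℝ) (A : Ω → ZMod 2) (Z : Ω → β) (z : β) :
    fibMass P Z z =
      fibMass P (fun ω => (A ω, Z ω)) (0, z) + fibMass P (fun ω => (A ω, Z ω)) (1, z) := by
  unfold fibMass
  rw [← Finset.sum_add_distrib]
  refine Finset.sum_congr rfl fun ω _ => ?_
  rcases zmod_two_eq_zero_or_one (A ω) with h | h <;> simp [h, Prod.ext_iff]

theorem wEnt_pair_sub [Fintype β] (P : Ω → ℝ) (A : Ω → ZMod 2) (Z : Ω → β) :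
    wEnt P (fun ω => (A ω, Z ω)) - wEnt P Z =
      ∑ z, massEnt (fibMass P (fun ω => (A ω, Z ω)) (0, z))
        (fibMass P (fun ω => (A ω, Z ω)) (1, z)) := by
  simp only [wEnt, massEnt, ← fibMass_eq_add, Fintype.sum_prod_type, sum_zmod_two,
    Finset.sum_add_distrib, Finset.sum_sub_distrib]

theorem wEnt_pair_sub_nonneg [Fintype β] {P : Ω → ℝ} (hP : ∀ ω, 0 ≤ P ω) (A : Ω → ZMod 2) (Z : Ω → β) :
    0 ≤ wEnt P (fun ω => (A ω, Z ω)) - wEnt P Z := by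
  rw [wEnt_pair_sub]
  exact Finset.sum_nonneg fun z _ => massEnt_nonneg (fibMass_nonneg hP _ _) (fibMass_nonneg hP _ _)

theorem wEnt_pair_sub_le [Fintype β] {P : Ω → ℝ} (hP : ∀ ω, 0 ≤ P ω) (hP1 : ∑ ω, P ω = 1)
    (A : Ω → ZMod 2) (Z : Ω → β) :
    wEnt P (fun ω => (A ω, Z ω)) - wEnt P Z ≤ Real.log 2 := by
  rw [wEnt_pair_sub]
  refine (Finset.sum_le_sum fun z _ =>
    massEnt_le (fibMass_nonneg hP _ _) (fibMass_nonneg hP _ _)).trans_eq ?_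
  simp only [← fibMass_eq_add]
  rw [← Finset.sum_mul, sum_fibMass, hP1, one_mul]

theorem fibMass_xor (P : Ω → ℝ) (A : Ω → ZMod 2) (Z : Ω → β) (s : ZMod 2) (z z' : β) :
    fibMass (fun ω : Ω × Ω => P ω.1 * P ω.2) (fun ω => (A ω.1 + A ω.2, (Z ω.1, Z ω.2)))
        (s, (z, z')) =
      fibMass P (fun ω => (A ω, Z ω)) (0, z) * fibMass P (fun ω => (A ω, Z ω)) (s, z') +
      fibMass P (fun ω => (A ω, Z ω)) (1, z) * fibMass P (fun ω => (A ω, Z ω)) (s + 1, z') := by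
  unfold fibMass
  rw [Finset.sum_mul_sum, Finset.sum_mul_sum, Fintype.sum_prod_type, ← Finset.sum_add_distrib]
  refine Finset.sum_congr rfl fun ω _ => ?_
  rw [← Finset.sum_add_distrib]
  refine Finset.sum_congr rfl fun ω' _ => ?_
  have key : ∀ a b : ZMod 2, 1 + a = b ↔ a = b + 1 := by decide
  rcases zmod_two_eq_zero_or_one (A ω) with h | h <;> by_cases h1 : Z ω = z <;>
    by_cases h2 : Z ω' = z' <;> simp [h, h1, h2, key]

theorem wEnt_xor_ge [Fintype β] {P : Ω → ℝ} (hP : ∀ ω, 0 ≤ P ω) (hP1 : ∑ ω, P ω = 1)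
    (A : Ω → ZMod 2) (Z : Ω → β) {h : ℝ} (hh : h = wEnt P (fun ω => (A ω, Z ω)) - wEnt P Z) :
    h + 2 / 9 * ((Real.log 2 - h) * h ^ 2) ≤
      wEnt (fun ω : Ω × Ω => P ω.1 * P ω.2) (fun ω => (A ω.1 + A ω.2, (Z ω.1, Z ω.2))) -
        wEnt (fun ω : Ω × Ω => P ω.1 * P ω.2) (fun ω => (Z ω.1, Z ω.2)) := by
  rw [wEnt_pair_sub] at hh
  rw [wEnt_pair_sub _ (fun ω : Ω × Ω => A ω.1 + A ω.2) (fun ω => (Z ω.1, Z ω.2)), hh,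
    Fintype.sum_prod_type]
  simp only [fibMass_xor, zero_add, show (1 : ZMod 2) + 1 = 0 from rfl]
  refine sum_massEnt_conv_ge (fun z => fibMass_nonneg hP _ _) (fun z => fibMass_nonneg hP _ _) ?_
  simp only [← fibMass_eq_add]
  rw [sum_fibMass, hP1]

end FiniteEntropy

section PolarTransform

/-- The `j`-th coordinate of the polar transform of `x`. -/
def polar (k : ℕ) (x : Fin (2 ^ k) → ZMod 2) (j : ℕ) : ZMod 2 :=
  ∑ i, x i * if j &&& i.val = j then 1 else 0

/-- The first `j` coordinates of the polar transform of `x`. -/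
def polarPrefix (k j : ℕ) (x : Fin (2 ^ k) → ZMod 2) : Fin j → ZMod 2 :=
  fun i => polar k x i

/-- Splitting a sequence into its even-indexed and odd-indexed halves. -/
def evenOddEquiv (k : ℕ) :
    (Fin (2 ^ (k + 1)) → ZMod 2) ≃ (Fin (2 ^ k) → ZMod 2) × (Fin (2 ^ k) → ZMod 2) :=
  (Equiv.arrowCongr ((finProdFinEquiv (m := 2 ^ k) (n := 2)).symm.trans
    ((Equiv.prodComm _ _).trans (finTwoEquiv.prodCongr (Equiv.refl _)))) (Equiv.refl _)).trans
    ((Equiv.curry _ _ _).trans (Equiv.boolArrowEquivProd _))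

theorem prod_evenOdd {M : Type*} [CommMonoid M] (k : ℕ) (f : ℕ → ZMod 2 → M)
    (x : Fin (2 ^ (k + 1)) → ZMod 2) :
    ∏ i, f i.val (x i) = ∏ i : Fin (2 ^ k), (f (2 * i.val) ((evenOddEquiv k x).1 i) *
      f (2 * i.val + 1) ((evenOddEquiv k x).2 i)) := by
  refine ((finProdFinEquiv (m := 2 ^ k) (n := 2)).prod_comp
    fun i : Fin (2 ^ k * 2) => f i.val (x i)).symm.trans ?_
  rw [Fintype.prod_prod_type]
  refine Finset.prod_congr rfl fun i _ => ?_
  rw [Fin.prod_univ_two]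
  congr 2
  · simp [finProdFinEquiv]
  · simp [finProdFinEquiv, add_comm]

theorem sum_evenOdd {M : Type*} [AddCommMonoid M] (k : ℕ) (f : ℕ → ZMod 2 → M)
    (x : Fin (2 ^ (k + 1)) → ZMod 2) :
    ∑ i, f i.val (x i) = ∑ i : Fin (2 ^ k), (f (2 * i.val) ((evenOddEquiv k x).1 i) +
      f (2 * i.val + 1) ((evenOddEquiv k x).2 i)) :=
  prod_evenOdd (M := Multiplicative M) k f x

theorem polar_even (k j : ℕ) (x : Fin (2 ^ (k + 1)) → ZMod 2) :
    polar (k + 1) x (2 * j) =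
      polar k (evenOddEquiv k x).1 j + polar k (evenOddEquiv k x).2 j := by
  unfold polar
  rw [sum_evenOdd k (fun i a => a * if (2 * j) &&& i = 2 * j then 1 else 0),
    ← Finset.sum_add_distrib]
  have h0 : ∀ i, (2 * j) &&& (2 * i) = 2 * j ↔ j &&& i = j := fun i => by
    have := Nat.land_bit false j false i
    simp only [Nat.bit, cond_false, Bool.and_false] at this
    omega
  have h1 : ∀ i, (2 * j) &&& (2 * i + 1) = 2 * j ↔ j &&& i = j := fun i => by
    have := Nat.land_bit false j true i
    simp only [Nat.bit, cond_true, cond_false, Bool.and_true] at this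
    omega
  simp only [h0, h1]

theorem polar_odd (k j : ℕ) (x : Fin (2 ^ (k + 1)) → ZMod 2) :
    polar (k + 1) x (2 * j + 1) = polar k (evenOddEquiv k x).2 j := by
  unfold polar
  rw [sum_evenOdd k (fun i a => a * if (2 * j + 1) &&& i = 2 * j + 1 then 1 else 0)]
  have h0 : ∀ i, ¬ (2 * j + 1) &&& (2 * i) = 2 * j + 1 := fun i => by
    have := Nat.land_bit true j false i
    simp only [Nat.bit, cond_true, cond_false, Bool.and_false] at this
    omega
  have h1 : ∀ i, (2 * j + 1) &&& (2 * i + 1) = 2 * j + 1 ↔ j &&& i = j := fun i => by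
    have := Nat.land_bit true j true i
    simp only [Nat.bit, cond_true, Bool.and_true] at this
    omega
  simp [h0, h1]

theorem polarPrefix_eq_iff {k j : ℕ} {x y : Fin (2 ^ k) → ZMod 2} :
    polarPrefix k j x = polarPrefix k j y ↔ ∀ i < j, polar k x i = polar k y i := by
  simp [funext_iff, polarPrefix, Fin.forall_iff]

theorem polarPrefix_succ_eq_iff {k j : ℕ} {x y : Fin (2 ^ k) → ZMod 2} :
    polarPrefix k (j + 1) x = polarPrefix k (j + 1) y ↔
      polar k x j = polar k y j ∧ polarPrefix k j x = polarPrefix k j y := by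
  simp only [polarPrefix_eq_iff, Nat.forall_lt_succ_right, and_comm]

theorem polarPrefix_two_mul_eq_iff {k j : ℕ} {x y : Fin (2 ^ (k + 1)) → ZMod 2} :
    polarPrefix (k + 1) (2 * j) x = polarPrefix (k + 1) (2 * j) y ↔
      polarPrefix k j (evenOddEquiv k x).1 = polarPrefix k j (evenOddEquiv k y).1 ∧
      polarPrefix k j (evenOddEquiv k x).2 = polarPrefix k j (evenOddEquiv k y).2 := by
  induction j with
  | zero => simp [polarPrefix_eq_iff]
  | succ j ih =>
    rw [show 2 * (j + 1) = 2 * j + 1 + 1 by ring, polarPrefix_succ_eq_iff,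
      polarPrefix_succ_eq_iff, ih, polarPrefix_succ_eq_iff, polarPrefix_succ_eq_iff,
      polar_odd, polar_odd, polar_even, polar_even]
    constructor
    · rintro ⟨h1, h2, h3, h4⟩
      rw [h1] at h2
      exact ⟨⟨add_right_cancel h2, h3⟩, h1, h4⟩
    · rintro ⟨⟨h1, h2⟩, h3, h4⟩
      exact ⟨h3, by rw [h1, h3], h2, h4⟩

variable (b : ZMod 2 → ℝ)

/-- The product weight on binary sequences. -/
noncomputable def prodWeight (k : ℕ) (x : Fin (2 ^ k) → ZMod 2) : ℝ := ∏ i, b (x i)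

/-- The entropy (in nats) of the first `j` coordinates of the polar transform. -/
noncomputable def prefixEnt (k j : ℕ) : ℝ := wEnt (prodWeight b k) (polarPrefix k j)

theorem prodWeight_succ (k : ℕ) :
    prodWeight b (k + 1) = (fun y => prodWeight b k y.1 * prodWeight b k y.2) ∘ evenOddEquiv k := by
  ext x
  simp only [prodWeight, Function.comp_apply]
  rw [prod_evenOdd k (fun _ a => b a), Finset.prod_mul_distrib]

variable {b}

theorem prodWeight_nonneg (hb : ∀ a, 0 ≤ b a) (k : ℕ) (x : Fin (2 ^ k) → ZMod 2) :
    0 ≤ prodWeight b k x := Finset.prod_nonneg fun _ _ => hb _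

theorem sum_prodWeight (hb1 : b 0 + b 1 = 1) (k : ℕ) : ∑ x, prodWeight b k x = 1 := by
  unfold prodWeight
  rw [← Fintype.prod_sum]
  simp [sum_zmod_two, hb1]

theorem prefixEnt_two_mul (hb1 : b 0 + b 1 = 1) (k j : ℕ) :
    prefixEnt b (k + 1) (2 * j) = 2 * prefixEnt b k j := by
  unfold prefixEnt
  rw [two_mul (wEnt _ _), ← wEnt_prod (sum_prodWeight hb1 k) (sum_prodWeight hb1 k),
    ← wEnt_comp_equiv (evenOddEquiv k), ← prodWeight_succ]
  exact wEnt_congr_of_ker _ fun x y => by simp [polarPrefix_two_mul_eq_iff]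

theorem prefixEnt_succ (k j : ℕ) : prefixEnt b k (j + 1) =
    wEnt (prodWeight b k) (fun x => (polar k x j, polarPrefix k j x)) :=
  wEnt_congr_of_ker _ fun x y => by simp [polarPrefix_succ_eq_iff]

theorem prefixEnt_two_mul_succ (k j : ℕ) : prefixEnt b (k + 1) (2 * j + 1) =
    wEnt (fun ω : _ × _ => prodWeight b k ω.1 * prodWeight b k ω.2)
      (fun ω => (polar k ω.1 j + polar k ω.2 j, (polarPrefix k j ω.1, polarPrefix k j ω.2))) := by
  unfold prefixEnt
  rw [← wEnt_comp_equiv (evenOddEquiv k), ← prodWeight_succ]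
  exact wEnt_congr_of_ker _ fun x y => by
    simp [polarPrefix_succ_eq_iff, polarPrefix_two_mul_eq_iff, polar_even]

theorem prefixEnt_two_mul_eq_prod (k j : ℕ) : prefixEnt b (k + 1) (2 * j) =
    wEnt (fun ω : _ × _ => prodWeight b k ω.1 * prodWeight b k ω.2)
      (fun ω => (polarPrefix k j ω.1, polarPrefix k j ω.2)) := by
  unfold prefixEnt
  rw [← wEnt_comp_equiv (evenOddEquiv k), ← prodWeight_succ]
  exact wEnt_congr_of_ker _ fun x y => by simp [polarPrefix_two_mul_eq_iff]

variable (b) in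
/-- The conditional entropy (in bits) of the `j`-th coordinate of the polar transform given the
preceding ones. -/
noncomputable def polarEnt (k j : ℕ) : ℝ :=
  (prefixEnt b k (j + 1) - prefixEnt b k j) / Real.log 2

theorem polarEnt_nonneg (hb : ∀ a, 0 ≤ b a) (k j : ℕ) : 0 ≤ polarEnt b k j := by
  rw [polarEnt, prefixEnt_succ]
  exact div_nonneg (wEnt_pair_sub_nonneg (prodWeight_nonneg hb k) _ _)
    (Real.log_nonneg one_le_two)

theorem polarEnt_le_one (hb : ∀ a, 0 ≤ b a) (hb1 : b 0 + b 1 = 1) (k j : ℕ) :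
    polarEnt b k j ≤ 1 := by
  rw [polarEnt, prefixEnt_succ]
  exact div_le_one_of_le₀ (wEnt_pair_sub_le (prodWeight_nonneg hb k) (sum_prodWeight hb1 k) _ _)
    (Real.log_nonneg one_le_two)

theorem polarEnt_split (hb1 : b 0 + b 1 = 1) (k j : ℕ) :
    polarEnt b (k + 1) (2 * j) + polarEnt b (k + 1) (2 * j + 1) = 2 * polarEnt b k j := by
  unfold polarEnt
  rw [← add_div, show 2 * j + 1 + 1 = 2 * (j + 1) by ring, prefixEnt_two_mul hb1,
    prefixEnt_two_mul hb1]
  ring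

theorem polarEnt_gap (hb : ∀ a, 0 ≤ b a) (hb1 : b 0 + b 1 = 1) (k j : ℕ) :
    polarEnt b k j + 2 / 9 * Real.log 2 ^ 2 * ((1 - polarEnt b k j) * polarEnt b k j ^ 2) ≤
      polarEnt b (k + 1) (2 * j) := by
  have hlog : 0 < Real.log 2 := Real.log_pos one_lt_two
  have h := wEnt_xor_ge (prodWeight_nonneg hb k) (sum_prodWeight hb1 k) (fun x => polar k x j)
    (polarPrefix k j) rfl
  rw [← prefixEnt_two_mul_succ, ← prefixEnt_two_mul_eq_prod, ← prefixEnt_succ] at h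
  change (prefixEnt b k (j + 1) - prefixEnt b k j) + 2 / 9 *
    ((Real.log 2 - (prefixEnt b k (j + 1) - prefixEnt b k j)) *
      (prefixEnt b k (j + 1) - prefixEnt b k j) ^ 2) ≤ _ at h
  unfold polarEnt
  rw [le_div_iff₀ hlog]
  refine le_trans (le_of_eq ?_) h
  field_simp

theorem polarEnt_zero_zero (hb1 : b 0 + b 1 = 1) :
    polarEnt b 0 0 = (Real.negMulLog (b 1) + Real.negMulLog (b 0)) / Real.log 2 := by
  have h0 : prefixEnt b 0 0 = 0 := by
    have : ∀ a, fibMass (prodWeight b 0) (polarPrefix 0 0) a = 1 := fun a => by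
      rw [← sum_prodWeight hb1 0]
      exact Finset.sum_congr rfl fun x _ => if_pos (Subsingleton.elim _ _)
    simp [prefixEnt, wEnt, this]
  have h1 : prefixEnt b 0 1 = Real.negMulLog (b 0) + Real.negMulLog (b 1) := by
    have e : prefixEnt b 0 1 = wEnt (prodWeight b 0) (fun x => x 0) :=
      wEnt_congr_of_ker _ fun x y => by
        simp [polarPrefix_succ_eq_iff, polarPrefix_eq_iff, polar]
    let u : (Fin (2 ^ 0) → ZMod 2) ≃ ZMod 2 := Equiv.funUnique (Fin 1) (ZMod 2)
    have hu : prodWeight b 0 = b ∘ u := by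
      ext x
      simp [prodWeight]
      rfl
    have e2 : wEnt (prodWeight b 0) (fun x => x 0) = wEnt b id := by
      rw [← wEnt_comp_equiv u, hu]
      rfl
    rw [e, e2]
    simp [wEnt, fibMass, sum_zmod_two]
  rw [polarEnt, h0, h1, sub_zero, add_comm]

end PolarTransform

theorem bern_singleton {p : ℝ} (a : ZMod 2) :
    bern p {a} = ENNReal.ofReal (if a = 1 then p else 1 - p) := by
  have h : (0 : ZMod 2) ≠ 1 := by decide
  rcases zmod_two_eq_zero_or_one a with rfl | rfl <;>
    simp [bern, h, Measure.dirac_apply' _ (MeasurableSet.singleton _)]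

theorem shEnt_comp_eq_wEnt {p : ℝ} (hp0 : 0 ≤ p) (hp1 : p ≤ 1) {k : ℕ} {Ω : Type*}
    [MeasurableSpace Ω] {μ : Measure Ω} {X : Ω → (Fin (2 ^ k) → ZMod 2)} (hmeas : Measurable X)
    (hiid : μ.map X = Measure.pi fun _ : Fin (2 ^ k) => bern p) {α : Type*} [Fintype α]
    (f : (Fin (2 ^ k) → ZMod 2) → α) :
    shEnt μ (fun ω => f (X ω)) =
      wEnt (prodWeight (fun a => if a = 1 then p else 1 - p) k) f / Real.log 2 := by
  have hb : ∀ a : ZMod 2, 0 ≤ (if a = 1 then p else 1 - p) := fun a => by split_ifs <;> linarith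
  have : IsProbabilityMeasure (bern p) := ⟨by
    simp only [bern, Measure.add_apply, Measure.smul_apply, measure_univ, smul_eq_mul, mul_one]
    rw [← ENNReal.ofReal_add (by linarith) hp0]
    simp⟩
  have hpt : ∀ x, (μ.map X) {x} =
      ENNReal.ofReal (prodWeight (fun a => if a = 1 then p else 1 - p) k x) := by
    intro x
    rw [hiid, Measure.pi_singleton, prodWeight, ENNReal.ofReal_prod_of_nonneg fun _ _ => hb _]
    simp only [bern_singleton]
  have hmass : ∀ a, (μ ((fun ω => f (X ω)) ⁻¹' {a})).toReal =
      fibMass (prodWeight (fun a => if a = 1 then p else 1 - p) k) f a := by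
    intro a
    have hset : (fun ω => f (X ω)) ⁻¹' {a} =
        X ⁻¹' ↑(Finset.univ.filter fun x => f x = a) := by
      ext
      simp
    rw [hset, ← Measure.map_apply hmeas (Finset.measurableSet _), ← sum_measure_singleton,
      ENNReal.toReal_sum fun x _ => by simp [hpt], fibMass, Finset.sum_filter]
    simp only [hpt, ENNReal.toReal_ofReal (prodWeight_nonneg hb k _)]
  simp only [shEnt, wEnt, hmass]

theorem vecMul_G (k : ℕ) (x : Fin (2 ^ k) → ZMod 2) (j : Fin (2 ^ k)) :
    Matrix.vecMul x (G k) j = polar k x j := by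
  simp [Matrix.vecMul, dotProduct, G, polar]

theorem cEnt_eq_polarEnt {p : ℝ} (hp0 : 0 ≤ p) (hp1 : p ≤ 1) {k : ℕ} {Ω : Type*}
    [MeasurableSpace Ω] {μ : Measure Ω} {X : Ω → (Fin (2 ^ k) → ZMod 2)} (hmeas : Measurable X)
    (hiid : μ.map X = Measure.pi fun _ : Fin (2 ^ k) => bern p) (j : Fin (2 ^ k)) :
    cEnt μ (fun ω => Matrix.vecMul (X ω) (G k) j)
        (fun ω (i : Fin j.val) => Matrix.vecMul (X ω) (G k) (i.castLE j.isLt.le)) =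
      polarEnt (fun a => if a = 1 then p else 1 - p) k j := by
  simp only [vecMul_G, Fin.val_castLE]
  rw [cEnt, polarEnt, prefixEnt_succ, prefixEnt, sub_div]
  exact congrArg₂ _
    (shEnt_comp_eq_wEnt hp0 hp1 hmeas hiid fun x => (polar k x j, polarPrefix k j x))
    (shEnt_comp_eq_wEnt hp0 hp1 hmeas hiid (polarPrefix k j))

/-- basic source polarization, Arıkan.
Let `p ∈ [0,1]`, `n = 2^k`, `X = [X_1,…,X_n]` i.i.d. Bernoulli(p) over `F₂` and
`Y = X ⬝ G_n`. For every `ε ∈ (0,1)`, the fraction of indices `j` with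
`H(Y_j | Y_1,…,Y_{j-1}) ≥ 1 - ε` tends to `h(p)` as `k → ∞`. -/
theorem statement0 (p : ℝ) (hp0 : 0 ≤ p) (hp1 : p ≤ 1) (ε : ℝ) (hε0 : 0 < ε) (hε1 : ε < 1)
    (Ω : ℕ → Type) [∀ k, MeasurableSpace (Ω k)] (μ : ∀ k, Measure (Ω k))
    (hprob : ∀ k, IsProbabilityMeasure (μ k))
    (X : ∀ k, Ω k → (Fin (2 ^ k) → ZMod 2))
    (hmeas : ∀ k, Measurable (X k))
    (hiid : ∀ k, (μ k).map (X k) = Measure.pi fun _ : Fin (2 ^ k) => bern p) :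
    Tendsto (fun k : ℕ =>
        (Nat.card {j : Fin (2 ^ k) //
            1 - ε ≤ cEnt (μ k) (fun ω => Matrix.vecMul (X k ω) (G k) j)
              (fun ω (i : Fin j.val) =>
                Matrix.vecMul (X k ω) (G k) (i.castLE j.isLt.le))} : ℝ) / 2 ^ k)
      atTop (nhds (binEnt p)) := by
  set b : ZMod 2 → ℝ := fun a => if a = 1 then p else 1 - p with hbdef
  have hb : ∀ a, 0 ≤ b a := fun a => by
    simp only [hbdef]
    split_ifs <;> linarith
  have hb1 : b 0 + b 1 = 1 := by simp [hbdef]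
  have h00 : polarEnt b 0 0 = binEnt p := by
    rw [polarEnt_zero_zero hb1]
    simp [hbdef, binEnt]
  have hlim := tendsto_dyadicAvg_indicator (g := polarEnt b)
    (mul_pos (by norm_num) (pow_pos (Real.log_pos one_lt_two) 2)) (polarEnt_nonneg hb)
    (polarEnt_le_one hb hb1) (polarEnt_split hb1) (polarEnt_gap hb hb1) hε0 hε1
  rw [h00] at hlim
  refine hlim.congr fun k => ?_
  rw [dyadicAvg, Finset.sum_range]
  simp only [cEnt_eq_polarEnt hp0 hp1 (hmeas k) (hiid k)]
  rw [Finset.sum_boole, Nat.card_eq_fintype_card, Fintype.card_subtype]
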